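/- arXiv:2005.07291 — 5 statements merged into one kernel-verified Lean document; each statement's English description precedes it below -/
import Mathlib

section
/- Let n ≥ 1 and let C2 ⊆ F_2^n be a linear binary code, and let Γ ⊆ ℤ^n be the Construction C* constellation built from the 3-level code C determined by C2. Then Γ is a lattice (i.e., an additive subgroup of ℝ^n) if and only if C2 is self-orthogonal and contains the all-ones vector (1,…,1). -/
open Finset

/-- The natural embedding `ψ : F_2^n → ℤ^n`, sending the bits 0,1 to the integers 0,1. -/
def psi {n : ℕ} (x : Fin n → ZMod 2) : Fin n → ℤ := fun i => ((x i).val : ℤ)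

/-- The Hamming weight of a binary vector. -/
def wt {n : ℕ} (x : Fin n → ZMod 2) : ℕ := (Finset.univ.filter fun i => x i ≠ 0).card

/-- Membership in the 3-level code `C ⊆ F_2^{3n}` determined by `C2`:
`(c1,c2,c3) ∈ C` iff `c2 ∈ C2` and either `c1 = (0,…,0)` with `c3` of even Hamming
weight, or `c1 = (1,…,1)` with `c3` of odd Hamming weight. -/
def inCode {n : ℕ} (C2 : Set (Fin n → ZMod 2)) (c1 c2 c3 : Fin n → ZMod 2) : Prop :=
  c2 ∈ C2 ∧ ((c1 = 0 ∧ Even (wt c3)) ∨ (c1 = 1 ∧ ¬ Even (wt c3)))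

/-- The Construction C* constellation `Γ = {c1 + 2 c2 + 4 c3 + 8 z : (c1,c2,c3) ∈ C, z ∈ ℤ^n}`. -/
def Gamma {n : ℕ} (C2 : Set (Fin n → ZMod 2)) : Set (Fin n → ℤ) :=
  { v | ∃ c1 c2 c3 : Fin n → ZMod 2, ∃ z : Fin n → ℤ,
      inCode C2 c1 c2 c3 ∧ v = psi c1 + 2 • psi c2 + 4 • psi c3 + 8 • z }

/-- Coordinatewise embedding of `ℤ^n` into `ℝ^n`. -/
def toReal {n : ℕ} (v : Fin n → ℤ) : Fin n → ℝ := fun i => (v i : ℝ)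

/-- A binary code is self-orthogonal if `⟨c, c'⟩ = 0` for all codewords `c, c'`. -/
def SelfOrthogonal {n : ℕ} (C : Set (Fin n → ZMod 2)) : Prop :=
  ∀ c ∈ C, ∀ c' ∈ C, ∑ i, c i * c' i = 0

lemma intCast_val_zmod_two (x : ZMod 2) : (((x.val : ℕ) : ℤ) : ZMod 2) = x := by
  simp

lemma wt_cast {n : ℕ} (x : Fin n → ZMod 2) : ((wt x : ℕ) : ZMod 2) = ∑ i, x i := by
  have h : ∀ y : ZMod 2, (if y ≠ 0 then (1 : ZMod 2) else 0) = y := by decide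
  rw [wt, Finset.natCast_card_filter]
  exact Finset.sum_congr rfl fun i _ => h (x i)

/-- Membership in `Γ`, with the third level and the translations by `8ℤ^n` merged into one
integer vector whose coordinate sum has the parity of the first level. -/
lemma mem_Gamma_iff {n : ℕ} {C : Set (Fin n → ZMod 2)} {v : Fin n → ℤ} :
    v ∈ Gamma C ↔ ∃ e : ZMod 2, ∃ a ∈ C, ∃ w : Fin n → ℤ,
      (∀ i, v i = e.val + 2 * (a i).val + 4 * w i) ∧ ∑ i, (w i : ZMod 2) = e := by
  have h8 : (2 : ZMod 2) = 0 := rfl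
  constructor
  · rintro ⟨c1, c2, c3, z, ⟨h2, h⟩, rfl⟩
    have hsum : ∑ i, (((c3 i).val + 2 * z i : ℤ) : ZMod 2) = wt c3 := by
      rw [wt_cast]
      simp [h8]
    rcases h with ⟨rfl, h⟩ | ⟨rfl, h⟩
    · refine ⟨0, c2, h2, fun i => (c3 i).val + 2 * z i, fun i => ?_, ?_⟩
      · simp [psi]
        ring
      · rw [hsum, ZMod.natCast_eq_zero_iff_even.2 h]
    · refine ⟨1, c2, h2, fun i => (c3 i).val + 2 * z i, fun i => ?_, ?_⟩
      · simp [psi, ZMod.val_one]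
        ring
      · rw [hsum, ZMod.natCast_eq_one_iff_odd.2 (Nat.not_even_iff_odd.1 h)]
  · rintro ⟨e, a, ha, w, hv, hw⟩
    refine ⟨fun _ => e, a, fun i => w i, fun i => w i / 2, ⟨ha, ?_⟩, ?_⟩
    · have he : ((wt fun i => (w i : ZMod 2) : ℕ) : ZMod 2) = e := by rw [wt_cast, hw]
      rcases (by decide : ∀ y : ZMod 2, y = 0 ∨ y = 1) e with rfl | rfl
      · exact .inl ⟨rfl, ZMod.natCast_eq_zero_iff_even.1 he⟩
      · exact .inr ⟨rfl, Nat.not_even_iff_odd.2 (ZMod.natCast_eq_one_iff_odd.1 he)⟩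
    · ext i
      have hval : (((w i : ZMod 2).val : ℕ) : ℤ) = w i % 2 := ZMod.val_intCast (n := 2) (w i)
      change v i = (e.val : ℤ) + 2 • ((a i).val : ℤ) + 4 • ((w i : ZMod 2).val : ℤ) + 8 • (w i / 2)
      rw [hv i, hval]
      clear h8 hval hv hw
      lia

lemma zero_mem_Gamma {n : ℕ} (C2 : Submodule (ZMod 2) (Fin n → ZMod 2)) :
    (0 : Fin n → ℤ) ∈ Gamma (C2 : Set (Fin n → ZMod 2)) :=
  mem_Gamma_iff.2 ⟨0, 0, C2.zero_mem, 0, by simp, by simp⟩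

lemma add_mem_Gamma {n : ℕ} {C2 : Submodule (ZMod 2) (Fin n → ZMod 2)}
    (hC : SelfOrthogonal (C2 : Set (Fin n → ZMod 2))) (h1 : (1 : Fin n → ZMod 2) ∈ C2)
    {u v : Fin n → ℤ} (hu : u ∈ Gamma (C2 : Set (Fin n → ZMod 2)))
    (hv : v ∈ Gamma (C2 : Set (Fin n → ZMod 2))) :
    u + v ∈ Gamma (C2 : Set (Fin n → ZMod 2)) := by
  obtain ⟨e, a, ha, w, hu, hw⟩ := mem_Gamma_iff.1 hu
  obtain ⟨f, b, hb, t, hv, ht⟩ := mem_Gamma_iff.1 hv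
  have carry : ∀ x y e f : ZMod 2, ((e.val + 2 * x.val + (f.val + 2 * y.val) : ℕ) : ℤ) =
      ((e + f).val + 2 * (x + y + e * f).val +
        4 * (x * y + x * (e * f) + y * (e * f)).val : ℕ) := by
    decide
  have hab := hC a ha b hb
  have ha1 : ∑ i, a i = 0 := by simpa using hC a ha 1 h1
  have hb1 : ∑ i, b i = 0 := by simpa using hC b hb 1 h1
  refine mem_Gamma_iff.2 ⟨e + f, a + b + (e * f) • 1,
    C2.add_mem (C2.add_mem ha hb) (C2.smul_mem _ h1),
    fun i => w i + t i + (a i * b i + a i * (e * f) + b i * (e * f)).val, fun i => ?_, ?_⟩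
  · have h := carry (a i) (b i) e f
    push_cast at h
    simp only [Pi.add_apply, Pi.smul_apply, Pi.one_apply, smul_eq_mul, mul_one, hu i, hv i]
    linarith
  · simp only [Int.cast_add, intCast_val_zmod_two, Finset.sum_add_distrib, ← Finset.sum_mul,
      hw, ht, hab, ha1, hb1]
    ring

lemma neg_mem_Gamma {n : ℕ} {C2 : Submodule (ZMod 2) (Fin n → ZMod 2)}
    (hC : SelfOrthogonal (C2 : Set (Fin n → ZMod 2))) (h1 : (1 : Fin n → ZMod 2) ∈ C2)
    {u : Fin n → ℤ} (hu : u ∈ Gamma (C2 : Set (Fin n → ZMod 2))) :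
    -u ∈ Gamma (C2 : Set (Fin n → ZMod 2)) := by
  obtain ⟨e, a, ha, w, hu, hw⟩ := mem_Gamma_iff.1 hu
  have borrow : ∀ x e : ZMod 2, -((e.val : ℤ) + 2 * x.val) =
      e.val + 2 * (x + e).val - 4 * (x + e * 1 + x * e).val := by
    decide
  have ha1 : ∑ i, a i = 0 := by simpa using hC a ha 1 h1
  have hn : (n : ZMod 2) = 0 := by simpa using hC 1 h1 1 h1
  refine mem_Gamma_iff.2 ⟨e, a + e • 1, C2.add_mem ha (C2.smul_mem _ h1),
    fun i => -w i - (a i + e * 1 + a i * e).val, fun i => ?_, ?_⟩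
  · have h := borrow (a i) e
    simp only [Pi.add_apply, Pi.neg_apply, Pi.smul_apply, Pi.one_apply, smul_eq_mul, hu i]
    simp only [mul_one] at h ⊢
    linarith
  · simp only [Int.cast_sub, Int.cast_neg, intCast_val_zmod_two, Finset.sum_sub_distrib,
      Finset.sum_neg_distrib, Finset.sum_add_distrib, ← Finset.sum_mul, hw, ha1]
    simp [hn]

/-- Doubling a sum of two bits yields an even number whose second and third binary digits
are their sum and their product modulo 2. -/
lemma carry_of_two_mul_add {x y b e : ZMod 2} {w : ℤ}
    (h : (2 * x.val + 2 * y.val : ℤ) = e.val + 2 * b.val + 4 * w) :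
    e = 0 ∧ b = x + y ∧ (w : ZMod 2) = x * y := by
  have bit : ∀ t : ZMod 2, t = 0 ∨ t = 1 := by decide
  rcases bit x with rfl | rfl <;> rcases bit y with rfl | rfl <;>
  rcases bit b with rfl | rfl <;> rcases bit e with rfl | rfl <;>
  simp [ZMod.val_one] at h <;> first
  | (exfalso; lia)
  | (obtain rfl : w = 0 := by lia
     decide)
  | (obtain rfl : w = 1 := by lia
     decide)

lemma selfOrthogonal_of_add_mem_Gamma {n : ℕ} (hn : 1 ≤ n) {C : Set (Fin n → ZMod 2)}
    (hadd : ∀ u ∈ Gamma C, ∀ v ∈ Gamma C, u + v ∈ Gamma C) : SelfOrthogonal C := by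
  intro a ha b hb
  have hmem : ∀ c ∈ C, (fun i => 2 * ((c i).val : ℤ)) ∈ Gamma C := fun c hc =>
    mem_Gamma_iff.2 ⟨0, c, hc, 0, by simp, by simp⟩
  obtain ⟨e, d, -, w, hv, hw⟩ := mem_Gamma_iff.1 (hadd _ (hmem a ha) _ (hmem b hb))
  have hcarry := fun i => carry_of_two_mul_add (hv i)
  rw [← (hcarry ⟨0, hn⟩).1, ← hw]
  exact Finset.sum_congr rfl fun i _ => (hcarry i).2.2.symm

lemma one_mem_of_add_mem_Gamma {n : ℕ} (hn : 1 ≤ n) {C : Set (Fin n → ZMod 2)} (h0 : 0 ∈ C)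
    (hadd : ∀ u ∈ Gamma C, ∀ v ∈ Gamma C, u + v ∈ Gamma C) : 1 ∈ C := by
  have hmem : (fun i => 1 + 4 * (Pi.single ⟨0, hn⟩ 1 : Fin n → ℤ) i) ∈ Gamma C :=
    mem_Gamma_iff.2 ⟨1, 0, h0, Pi.single ⟨0, hn⟩ 1, by simp [ZMod.val_one], by
      rw [← Int.cast_sum]; simp⟩
  obtain ⟨e, d, hd, w, hv, -⟩ := mem_Gamma_iff.1 (hadd _ hmem _ hmem)
  convert hd using 1
  ext i
  have h := hv i
  have hcarry := carry_of_two_mul_add (x := 1) (y := 0) (b := d i) (e := e)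
    (w := w i - 2 * (Pi.single ⟨0, hn⟩ 1 : Fin n → ℤ) i) (by
      simp only [Pi.add_apply] at h
      simp only [ZMod.val_one, ZMod.val_zero]
      push_cast
      linarith)
  simpa using hcarry.2.1.symm

lemma toReal_injective {n : ℕ} : Function.Injective (toReal (n := n)) := fun _ _ h =>
  funext fun i => Int.cast_injective (congrFun h i)

lemma toReal_add {n : ℕ} (u v : Fin n → ℤ) : toReal (u + v) = toReal u + toReal v := by
  ext i
  simp [toReal]

lemma toReal_neg {n : ℕ} (u : Fin n → ℤ) : toReal (-u) = -toReal u := by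
  ext i
  simp [toReal]

lemma toReal_zero {n : ℕ} : toReal (0 : Fin n → ℤ) = 0 := by
  ext i
  simp [toReal]

/-- `Γ` is a lattice (an additive subgroup of `ℝ^n`) iff `C2` is
self-orthogonal and contains the all-ones vector. -/
theorem constructionCstar_lattice_iff (n : ℕ) (hn : 1 ≤ n)
    (C2 : Submodule (ZMod 2) (Fin n → ZMod 2)) :
    (∃ H : AddSubgroup (Fin n → ℝ), toReal '' Gamma (C2 : Set (Fin n → ZMod 2)) = ↑H) ↔
      (SelfOrthogonal (C2 : Set (Fin n → ZMod 2)) ∧ (1 : Fin n → ZMod 2) ∈ C2) := by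
  constructor
  · rintro ⟨H, hH⟩
    have hadd : ∀ u ∈ Gamma (C2 : Set (Fin n → ZMod 2)),
        ∀ v ∈ Gamma (C2 : Set (Fin n → ZMod 2)), u + v ∈ Gamma (C2 : Set (Fin n → ZMod 2)) := fun u hu v hv => by
      have hmem : ∀ x, x ∈ Gamma (C2 : Set (Fin n → ZMod 2)) ↔ toReal x ∈ H := fun x => by
        rw [← SetLike.mem_coe, ← hH, toReal_injective.mem_set_image]
      rw [hmem, toReal_add]
      exact H.add_mem ((hmem u).1 hu) ((hmem v).1 hv)
    exact ⟨selfOrthogonal_of_add_mem_Gamma hn hadd,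
      one_mem_of_add_mem_Gamma hn C2.zero_mem hadd⟩
  · rintro ⟨hC, h1⟩
    refine ⟨{ carrier := toReal '' Gamma (C2 : Set (Fin n → ZMod 2))
              zero_mem' := ⟨0, zero_mem_Gamma C2, toReal_zero⟩
              add_mem' := ?_
              neg_mem' := ?_ }, rfl⟩
    · rintro _ _ ⟨u, hu, rfl⟩ ⟨v, hv, rfl⟩
      exact ⟨u + v, add_mem_Gamma hC h1 hu hv, toReal_add u v⟩
    · rintro _ ⟨u, hu, rfl⟩
      exact ⟨-u, neg_mem_Gamma hC h1 hu, toReal_neg u⟩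
end

section
/- Let n ≥ 1 and let C2 ⊆ F_2^n be a linear binary code, and let Γ ⊆ ℤ^n be the Construction C* constellation built from the 3-level code C determined by C2. If Γ is closed under (real) addition, then the all-ones vector (1,…,1) belongs to C2. -/
open Finset

/-- if `Γ` is closed under (real) addition then the all-ones vector lies in `C2`. -/
theorem allOnes_mem_of_closed_under_add (n : ℕ) (hn : 1 ≤ n)
    (C2 : Submodule (ZMod 2) (Fin n → ZMod 2))
    (hclosed : ∀ x ∈ Gamma (C2 : Set (Fin n → ZMod 2)),
      ∀ y ∈ Gamma (C2 : Set (Fin n → ZMod 2)), x + y ∈ Gamma (C2 : Set (Fin n → ZMod 2))) :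
    (1 : Fin n → ZMod 2) ∈ C2 := by
  have hodd : psi 1 + 2 • psi 0 + 4 • psi (Pi.single ⟨0, hn⟩ 1) + 8 • (0 : Fin n → ℤ)
      ∈ Gamma (C2 : Set (Fin n → ZMod 2)) := by
    refine ⟨1, 0, Pi.single ⟨0, hn⟩ 1, 0, ⟨C2.zero_mem, Or.inr ⟨rfl, ?_⟩⟩, rfl⟩
    simp [wt, Pi.single_apply, Finset.filter_eq']
  obtain ⟨c1, c2, c3, z, ⟨hc2, hc⟩, hsum⟩ := hclosed _ hodd _ hodd
  suffices h : (1 : Fin n → ZMod 2) = c2 from h ▸ hc2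
  funext i
  have hi := congrFun hsum i
  have hval : ((1 : ZMod 2).val : ℤ) = 1 := rfl
  have hlt := ZMod.val_lt (c2 i)
  simp only [psi, Pi.add_apply, Pi.smul_apply, Pi.zero_apply, Pi.one_apply, ZMod.val_zero,
    hval] at hi
  rcases hc with ⟨rfl, -⟩ | ⟨rfl, -⟩
  · apply ZMod.val_injective 2
    simp only [Pi.zero_apply, ZMod.val_zero] at hi
    change 1 = (c2 i).val
    simp only [nsmul_eq_mul] at hi
    push_cast at hi
    omega
  · simp only [Pi.one_apply, hval] at hi
    simp only [nsmul_eq_mul] at hi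
    push_cast at hi
    omega
end

section
/- Let n ≥ 1 and let C2 ⊆ F_2^n be a linear binary code, and let Γ ⊆ ℤ^n be the Construction C* constellation built from the 3-level code C determined by C2. If Γ is closed under (real) addition, then C2 is self-orthogonal, i.e., ⟨c, c'⟩ = 0 in F_2 for all c, c' ∈ C2. -/
open Finset

/-- The Hamming weight of a binary vector reduces modulo 2 to the sum of its coordinates. -/
theorem natCast_wt {n : ℕ} (x : Fin n → ZMod 2) : (wt x : ZMod 2) = ∑ i, x i := by
  have h : ∀ a : ZMod 2, (if a ≠ 0 then (1 : ZMod 2) else 0) = a := by decide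
  simp only [wt, Finset.natCast_card_filter, h]

/-- Doubling a codeword of `C2` gives a point of the constellation. -/
theorem two_smul_psi_mem_Gamma {n : ℕ} {C2 : Set (Fin n → ZMod 2)} {c : Fin n → ZMod 2}
    (hc : c ∈ C2) : 2 • psi c ∈ Gamma C2 := by
  refine ⟨0, c, 0, 0, ⟨hc, Or.inl ⟨rfl, by simp [wt]⟩⟩, ?_⟩
  ext i
  simp [psi]

/-- The first and third binary digits of a sum `2a + 2b` of doubled bits. -/
theorem digits_of_two_mul_add_two_mul (a b p q r : ZMod 2) (z : ℤ)
    (h : 2 * (a.val : ℤ) + 2 * b.val = p.val + 2 * q.val + 4 * r.val + 8 * z) :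
    p = 0 ∧ r = a * b := by
  have hmod : (2 * (a.val : ZMod 8) + 2 * b.val) = p.val + 2 * q.val + 4 * r.val := by
    have h8 : (8 : ZMod 8) = 0 := rfl
    simpa [h8] using congrArg (Int.cast : ℤ → ZMod 8) h
  clear h
  decide +revert

/-- if `Γ` is closed under (real) addition then `C2` is self-orthogonal. -/
theorem selfOrthogonal_of_closed_under_add (n : ℕ) (hn : 1 ≤ n)
    (C2 : Submodule (ZMod 2) (Fin n → ZMod 2))
    (hclosed : ∀ x ∈ Gamma (C2 : Set (Fin n → ZMod 2)),
      ∀ y ∈ Gamma (C2 : Set (Fin n → ZMod 2)), x + y ∈ Gamma (C2 : Set (Fin n → ZMod 2))) :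
    SelfOrthogonal (C2 : Set (Fin n → ZMod 2)) := by
  intro c hc c' hc'
  obtain ⟨c1, c2, c3, z, ⟨-, hcode⟩, hsum⟩ :=
    hclosed _ (two_smul_psi_mem_Gamma hc) _ (two_smul_psi_mem_Gamma hc')
  have hdigits (i : Fin n) : c1 i = 0 ∧ c3 i = c i * c' i :=
    digits_of_two_mul_add_two_mul _ _ _ (c2 i) _ (z i)
      (by simpa [psi] using congrFun hsum i)
  have hc3 : ∑ i, c i * c' i = (wt c3 : ZMod 2) := by
    rw [natCast_wt]
    exact Finset.sum_congr rfl fun i _ => (hdigits i).2.symm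
  rcases hcode with ⟨-, heven⟩ | ⟨rfl, -⟩
  · rw [hc3]
    exact (ZMod.natCast_eq_zero_iff_even).2 heven
  · exact absurd (hdigits ⟨0, hn⟩).1 one_ne_zero
end

section
/- Let n ≥ 1 and let C2 ⊆ F_2^n be a linear binary code that is self-orthogonal and contains the all-ones vector (1,…,1). Then the Construction C* constellation Γ ⊆ ℤ^n built from the 3-level code C determined by C2 is an additive subgroup of ℝ^n (hence a lattice). -/
open Finset

theorem intCast_psi {n : ℕ} (x : Fin n → ZMod 2) (i : Fin n) : ((psi x i : ℤ) : ZMod 2) = x i := by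
  simp [psi]

theorem even_wt_iff {n : ℕ} (x : Fin n → ZMod 2) : Even (wt x) ↔ ∑ i, x i = 0 := by
  rw [← natCast_wt, ZMod.natCast_eq_zero_iff_even]

/-- Adding embedded bits produces a carry, namely twice the product of the bits. -/
theorem psi_add {n : ℕ} (x y : Fin n → ZMod 2) (i : Fin n) :
    psi x i + psi y i = psi (x + y) i + 2 * psi (x * y) i := by
  have h : ∀ a b : ZMod 2,
      ((a.val : ℤ) + b.val) = ((a + b).val : ℤ) + 2 * ((a * b).val : ℤ) := by decide
  exact h (x i) (y i)

theorem psi_intCast_mod_two {n : ℕ} (w : Fin n → ℤ) (i : Fin n) :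
    psi (fun j => (w j : ZMod 2)) i = w i % 2 := by
  exact ZMod.val_intCast (n := 2) (w i)

/-- The integer vectors `k + 2 a + 4 w` with `a` a codeword and `∑ w ≡ k (mod 2)`. -/
def constellationSubgroup {n : ℕ} (C2 : Submodule (ZMod 2) (Fin n → ZMod 2))
    (hso : SelfOrthogonal (C2 : Set (Fin n → ZMod 2)))
    (hone : (1 : Fin n → ZMod 2) ∈ C2) : AddSubgroup (Fin n → ℤ) where
  carrier := { v | ∃ k : ℤ, ∃ a ∈ C2, ∃ w : Fin n → ℤ,
    (∑ i, (w i : ZMod 2) = k) ∧ ∀ i, v i = k + 2 * psi a i + 4 * w i }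
  zero_mem' := ⟨0, 0, C2.zero_mem, 0, by simp, by simp [psi]⟩
  add_mem' := by
    rintro u v ⟨k, a, ha, w, hw, hu⟩ ⟨l, b, hb, x, hx, hv⟩
    refine ⟨k + l, a + b, C2.add_mem ha hb, w + x + psi (a * b), ?_, fun i => ?_⟩
    · simp [Finset.sum_add_distrib, hw, hx, intCast_psi, hso a ha b hb]
    · have := psi_add a b i
      simp only [Pi.add_apply, hu, hv]
      linarith
  neg_mem' := by
    rintro u ⟨k, a, ha, w, hw, hu⟩
    refine ⟨-k, a, ha, -w - psi a, ?_, fun i => ?_⟩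
    · have := hso a ha 1 hone
      simp_all [Finset.sum_sub_distrib, intCast_psi]
    · simp only [Pi.neg_apply, Pi.sub_apply, hu]
      ring

theorem Gamma_eq_constellationSubgroup {n : ℕ} (C2 : Submodule (ZMod 2) (Fin n → ZMod 2))
    (hso : SelfOrthogonal (C2 : Set (Fin n → ZMod 2)))
    (hone : (1 : Fin n → ZMod 2) ∈ C2) :
    Gamma (C2 : Set (Fin n → ZMod 2)) = constellationSubgroup C2 hso hone := by
  have two_eq_zero : (2 : ZMod 2) = 0 := by decide
  ext v
  constructor
  · rintro ⟨c1, c2, c3, z, ⟨h2, h⟩, rfl⟩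
    rw [even_wt_iff] at h
    obtain ⟨k, hk, hc⟩ : ∃ k : ℤ, (∑ i, c3 i = (k : ZMod 2)) ∧ ∀ i, psi c1 i = k := by
      rcases h with ⟨rfl, h⟩ | ⟨rfl, h⟩
      · exact ⟨0, by simpa using h, by simp [psi]⟩
      · refine ⟨1, ?_, by simp [psi, ZMod.val_one]⟩
        rw [Int.cast_one]
        exact Fin.eq_one_of_ne_zero _ h
    refine ⟨k, c2, h2, psi c3 + 2 • z, ?_, fun i => ?_⟩
    · simp [intCast_psi, two_eq_zero, hk]
    · simp [hc]
      ring
  · rintro ⟨k, a, ha, w, hw, hv⟩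
    let b : Fin n → ZMod 2 := fun _ => ((k / 2 : ℤ) : ZMod 2)
    have hb : b ∈ C2 := by
      have := C2.smul_mem ((k / 2 : ℤ) : ZMod 2) hone
      convert this using 1
      ext i
      simp [b]
    let x : Fin n → ℤ := fun i => w i + k / 2 / 2 + psi (a * b) i
    have hn : (n : ZMod 2) = 0 := by simpa using hso 1 hone 1 hone
    have hx : ∑ i, (x i : ZMod 2) = k := by
      simp [x, Finset.sum_add_distrib, hw, intCast_psi, hso a ha b hb, hn]
    refine ⟨fun _ => (k : ZMod 2), a + b, fun i => (x i : ZMod 2), fun i => x i / 2,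
      ⟨C2.add_mem ha hb, ?_⟩, funext fun i => ?_⟩
    · rw [even_wt_iff, hx]
      by_cases hk : (k : ZMod 2) = 0
      · exact Or.inl ⟨funext fun _ => hk, hk⟩
      · exact Or.inr ⟨funext fun _ => Fin.eq_one_of_ne_zero _ hk, hk⟩
    · have hab := psi_add a b i
      have hb2 : psi b i = k / 2 % 2 := psi_intCast_mod_two (fun _ => k / 2) i
      have hk := psi_intCast_mod_two (fun _ : Fin n => k) i
      have hxi := psi_intCast_mod_two x i
      have hxd : x i = w i + k / 2 / 2 + psi (a * b) i := rfl
      change v i = psi _ i + 2 • psi _ i + 4 • psi _ i + 8 • (x i / 2)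
      rw [hv, hk, hxi]
      simp only [nsmul_eq_mul]
      push_cast
      omega

/-- if `C2` is self-orthogonal and contains the all-ones vector, then `Γ` is an
additive subgroup of `ℝ^n`, hence a lattice. -/
theorem constructionCstar_isLattice (n : ℕ) (hn : 1 ≤ n)
    (C2 : Submodule (ZMod 2) (Fin n → ZMod 2))
    (hso : SelfOrthogonal (C2 : Set (Fin n → ZMod 2)))
    (hone : (1 : Fin n → ZMod 2) ∈ C2) :
    ∃ H : AddSubgroup (Fin n → ℝ), toReal '' Gamma (C2 : Set (Fin n → ZMod 2)) = ↑H := by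
  refine ⟨(constellationSubgroup C2 hso hone).map
    ((Int.castAddHom ℝ).compLeft (Fin n)), ?_⟩
  rw [Gamma_eq_constellationSubgroup C2 hso hone]
  rfl
end

section
/- Let C2 ⊆ F_2^{40} be any self-dual linear binary code of length 40 whose minimum Hamming weight is 8 (an extremal [40,20,8] self-dual code), and let Γ ⊆ ℤ^{40} be the Construction C* constellation built from the 3-level code C determined by C2. Then Γ is an additive subgroup of ℤ^{40} of index 2^60, and the minimum squared Euclidean norm of a nonzero element of Γ is 32. Consequently the Hermite invariant d_min^2 / vol^{2/40} of this lattice equals 4, the Hermite constant of the extremal even unimodular lattice in dimension 40. -/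
open Finset

/-- The dual of a binary code `C ⊆ F_2^n`. -/
def dualCode {n : ℕ} (C : Set (Fin n → ZMod 2)) : Set (Fin n → ZMod 2) :=
  { x | ∀ c ∈ C, ∑ i, x i * c i = 0 }

/-- Coordinatewise reduction modulo 2. -/
def reduceTwo (n : ℕ) : (Fin n → ℤ) →+ (Fin n → ZMod 2) where
  toFun u := fun i => (u i : ZMod 2)
  map_zero' := by ext; simp
  map_add' _ _ := by ext; simp

@[simp]
theorem reduceTwo_apply {n : ℕ} (u : Fin n → ℤ) (i : Fin n) : reduceTwo n u i = (u i : ZMod 2) :=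
  rfl

theorem psi_reduceTwo {n : ℕ} (u : Fin n → ℤ) (i : Fin n) : psi (reduceTwo n u) i = u i % 2 := by
  simpa [psi] using ZMod.val_intCast (n := 2) (u i)

theorem reduceTwo_psi {n : ℕ} (c : Fin n → ZMod 2) : reduceTwo n (psi c) = c := by
  ext i
  simp [psi]

theorem reduceTwo_surjective (n : ℕ) : Function.Surjective (reduceTwo n) :=
  fun c => ⟨psi c, reduceTwo_psi c⟩

theorem reduceTwo_eq_zero_iff {n : ℕ} (u : Fin n → ℤ) : reduceTwo n u = 0 ↔ ∀ i, 2 ∣ u i := by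
  simp [funext_iff, ZMod.intCast_eq_zero_iff_even, even_iff_two_dvd]

theorem reduceTwo_const_mul {n : ℕ} (u : Fin n → ℤ) : reduceTwo n (fun i => 2 * u i) = 0 := by
  simp [reduceTwo_eq_zero_iff]

theorem psi_eq_zero_or_one {n : ℕ} (c : Fin n → ZMod 2) (i : Fin n) : psi c i = 0 ∨ psi c i = 1 := by
  have h : (c i).val < 2 := ZMod.val_lt _
  simp only [psi]
  omega

theorem psi_eq_one_of_ne_zero {n : ℕ} {c : Fin n → ZMod 2} {i : Fin n} (h : c i ≠ 0) :
    psi c i = 1 := by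
  rcases psi_eq_zero_or_one c i with h0 | h1
  · exact absurd ((ZMod.val_eq_zero _).1 (Int.natCast_eq_zero.1 h0)) h
  · exact h1

theorem sum_psi {n : ℕ} (c : Fin n → ZMod 2) : ∑ i, psi c i = (wt c : ℤ) := by
  rw [wt, Finset.card_filter, Nat.cast_sum]
  refine Finset.sum_congr rfl fun i _ => ?_
  by_cases h : c i = 0
  · simp [psi, h]
  · simp [psi_eq_one_of_ne_zero h, h]

/-- The integral form `∑ (u i ^ 2 - u i)`, whose class modulo 4 is the defect between the weight of
`u` modulo 2 and the coordinate sum of `u`. -/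
def weightDefect {n : ℕ} (u : Fin n → ℤ) : ℤ := ∑ i, (u i ^ 2 - u i)

theorem weightDefect_add {n : ℕ} (u v : Fin n → ℤ) :
    weightDefect (u + v) = weightDefect u + weightDefect v + 2 * ∑ i, u i * v i := by
  simp only [weightDefect, Finset.mul_sum, ← Finset.sum_add_distrib, Pi.add_apply]
  exact Finset.sum_congr rfl fun i _ => by ring

theorem weightDefect_neg {n : ℕ} (u : Fin n → ℤ) :
    weightDefect (-u) = weightDefect u + 2 * ∑ i, u i := by
  simp only [weightDefect, Finset.mul_sum, ← Finset.sum_add_distrib, Pi.neg_apply]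
  exact Finset.sum_congr rfl fun i _ => by ring

theorem weightDefect_add_const {n : ℕ} (u : Fin n → ℤ) (k : ℤ) :
    weightDefect (fun i => u i + k) = weightDefect u + 2 * (k * ∑ i, u i) + n * (k ^ 2 - k) := by
  have h : (n : ℤ) * (k ^ 2 - k) = ∑ _i : Fin n, (k ^ 2 - k) := by simp [mul_sub]
  rw [h]
  simp only [weightDefect, Finset.mul_sum, ← Finset.sum_add_distrib]
  exact Finset.sum_congr rfl fun i _ => by ring

section SelfOrthogonalCode

variable {n : ℕ} {C : Submodule (ZMod 2) (Fin n → ZMod 2)}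

theorem SelfOrthogonal.two_dvd_sum_mul (hC : SelfOrthogonal (C : Set (Fin n → ZMod 2)))
    {u v : Fin n → ℤ} (hu : reduceTwo n u ∈ C) (hv : reduceTwo n v ∈ C) :
    2 ∣ ∑ i, u i * v i := by
  rw [← even_iff_two_dvd, ← ZMod.intCast_eq_zero_iff_even]
  simpa using hC _ hu _ hv

theorem SelfOrthogonal.two_dvd_sum (hC : SelfOrthogonal (C : Set (Fin n → ZMod 2)))
    {u : Fin n → ℤ} (hu : reduceTwo n u ∈ C) : 2 ∣ ∑ i, u i := by
  rw [← even_iff_two_dvd, ← ZMod.intCast_eq_zero_iff_even]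
  have hsq : ∀ x : ZMod 2, x * x = x := by decide
  simpa [hsq] using hC _ hu _ hu

/-- The lattice of integer vectors whose reduction lies in `C` and whose weight defect vanishes
modulo 4; twice it is the even part of the Construction C* lattice. -/
def defectSubgroup (C : Submodule (ZMod 2) (Fin n → ZMod 2))
    (hC : SelfOrthogonal (C : Set (Fin n → ZMod 2))) : AddSubgroup (Fin n → ℤ) where
  carrier := {u | reduceTwo n u ∈ C ∧ 4 ∣ weightDefect u}
  zero_mem' := by simp [weightDefect]
  add_mem' := by
    rintro u v ⟨hu, hu'⟩ ⟨hv, hv'⟩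
    refine ⟨by simpa using C.add_mem hu hv, ?_⟩
    have := hC.two_dvd_sum_mul hu hv
    rw [weightDefect_add]
    omega
  neg_mem' := by
    rintro u ⟨hu, hu'⟩
    refine ⟨by simpa using hu, ?_⟩
    have := hC.two_dvd_sum hu
    rw [weightDefect_neg]
    omega

/-- The Construction C* lattice of a self-orthogonal code. -/
def cstarSubgroup (C : Submodule (ZMod 2) (Fin n → ZMod 2))
    (hC : SelfOrthogonal (C : Set (Fin n → ZMod 2))) : AddSubgroup (Fin n → ℤ) where
  carrier := {v | ∃ e : ℤ, ∃ u : Fin n → ℤ,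
    reduceTwo n u ∈ C ∧ 4 ∣ weightDefect u - 2 * e ∧ v = fun i => e + 2 * u i}
  zero_mem' := ⟨0, 0, by simp, by simp [weightDefect], by ext; simp⟩
  add_mem' := by
    rintro _ _ ⟨e, u, hu, hu', rfl⟩ ⟨f, v, hv, hv', rfl⟩
    refine ⟨e + f, u + v, by simpa using C.add_mem hu hv, ?_, ?_⟩
    · have := hC.two_dvd_sum_mul hu hv
      rw [weightDefect_add]
      omega
    · ext i
      simp only [Pi.add_apply]
      ring
  neg_mem' := by
    rintro _ ⟨e, u, hu, hu', rfl⟩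
    refine ⟨-e, -u, by simpa using hu, ?_, ?_⟩
    · have := hC.two_dvd_sum hu
      rw [weightDefect_neg]
      omega
    · ext i
      simp only [Pi.neg_apply]
      ring

variable (hC : SelfOrthogonal (C : Set (Fin n → ZMod 2)))

/-- The constant offset of a point of the Construction C* lattice may be taken to be 0 or 1. -/
theorem exists_offset_of_mem_cstarSubgroup (hn : Even n) (h1 : (1 : Fin n → ZMod 2) ∈ C)
    {v : Fin n → ℤ} (hv : v ∈ cstarSubgroup C hC) :
    ∃ e : ℤ, (e = 0 ∨ e = 1) ∧ ∃ u : Fin n → ℤ,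
      reduceTwo n u ∈ C ∧ 4 ∣ weightDefect u - 2 * e ∧ v = fun i => e + 2 * u i := by
  obtain ⟨e, u, hu, hu', rfl⟩ := hv
  refine ⟨e % 2, Int.emod_two_eq_zero_or_one e, fun i => u i + e / 2, ?_, ?_, ?_⟩
  · have : reduceTwo n (fun i => u i + e / 2) =
        reduceTwo n u + ((e / 2 : ℤ) : ZMod 2) • (1 : Fin n → ZMod 2) := by
      ext i
      simp
    rw [this]
    exact C.add_mem hu (C.smul_mem _ h1)
  · rw [weightDefect_add_const]
    have h2 : (2 : ℤ) ∣ e / 2 * ∑ i, u i := (hC.two_dvd_sum hu).mul_left _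
    have h3 : (2 : ℤ) * 2 ∣ n * ((e / 2) ^ 2 - e / 2) := by
      refine mul_dvd_mul ?_ ?_
      · exact_mod_cast hn.two_dvd
      · have := (Int.even_mul_pred_self (e / 2)).two_dvd
        rwa [mul_sub, mul_one, ← sq] at this
    omega
  · ext i
    dsimp only
    omega

theorem gamma_eq_cstarSubgroup (hn : Even n) (h1 : (1 : Fin n → ZMod 2) ∈ C) :
    Gamma (C : Set (Fin n → ZMod 2)) = cstarSubgroup C hC := by
  have key : ∀ (a b : Fin n → ZMod 2) (z : Fin n → ℤ),
      4 ∣ weightDefect (fun i => psi a i + 2 * psi b i + 4 * z i) + 2 * wt b := by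
    intro a b z
    rw [← sum_psi, weightDefect, Finset.mul_sum, ← Finset.sum_add_distrib]
    refine Finset.dvd_sum fun i _ => ?_
    refine ⟨psi a i * psi b i + psi b i ^ 2 + 2 * psi a i * z i + 4 * psi b i * z i
      + 4 * z i ^ 2 - z i, ?_⟩
    have ha : psi a i ^ 2 = psi a i := by rcases psi_eq_zero_or_one a i with h | h <;> simp [h]
    linear_combination ha
  have hred : ∀ (a b : Fin n → ZMod 2) (z : Fin n → ℤ),
      reduceTwo n (fun i => psi a i + 2 * psi b i + 4 * z i) = a := by
    intro a b z
    have : (fun i => psi a i + 2 * psi b i + 4 * z i) =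
        psi a + fun i => 2 * (psi b i + 2 * z i) := by
      ext i
      simp only [Pi.add_apply]
      ring
    rw [this, map_add, reduceTwo_const_mul, reduceTwo_psi, add_zero]
  ext v
  constructor
  · rintro ⟨c1, c2, c3, z, ⟨hc2, hc⟩, rfl⟩
    have hk := key c2 c3 z
    rcases hc with ⟨rfl, hev⟩ | ⟨rfl, hodd⟩
    · refine ⟨0, _, by rw [hred c2 c3 z]; exact hc2, ?_, ?_⟩
      · have := hev.two_dvd
        omega
      · ext i
        simp [psi]
        ring
    · refine ⟨1, _, by rw [hred c2 c3 z]; exact hc2, ?_, ?_⟩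
      · rw [Nat.even_iff] at hodd
        omega
      · ext i
        have : ((1 : ZMod 2).val : ℤ) = 1 := rfl
        simp [psi, this]
        ring
  · intro hv
    obtain ⟨e, he, u, hu, hu', rfl⟩ := exists_offset_of_mem_cstarSubgroup hC hn h1 hv
    set c3 : Fin n → ZMod 2 := reduceTwo n fun i => u i / 2 with hc3
    have hdec : u = fun i => psi (reduceTwo n u) i + 2 * psi c3 i + 4 * (u i / 4) := by
      ext i
      rw [hc3, psi_reduceTwo, psi_reduceTwo]
      omega
    have hk := key (reduceTwo n u) c3 fun i => u i / 4
    rw [← hdec] at hk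
    rcases he with rfl | rfl
    · refine ⟨0, reduceTwo n u, c3, fun i => u i / 4, ⟨hu, Or.inl ⟨rfl, ?_⟩⟩, ?_⟩
      · rw [Nat.even_iff]
        omega
      · ext i
        have := congrFun hdec i
        simp only [Pi.add_apply, nsmul_eq_mul, Pi.mul_apply, Pi.ofNat_apply,
          Nat.cast_ofNat]
        have h0 : psi (0 : Fin n → ZMod 2) i = 0 := by simp [psi]
        linarith
    · refine ⟨1, reduceTwo n u, c3, fun i => u i / 4, ⟨hu, Or.inr ⟨rfl, ?_⟩⟩, ?_⟩
      · rw [Nat.even_iff]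
        omega
      · ext i
        have := congrFun hdec i
        simp only [Pi.add_apply, nsmul_eq_mul, Pi.mul_apply, Pi.ofNat_apply,
          Nat.cast_ofNat]
        have h0 : psi (1 : Fin n → ZMod 2) i = 1 := rfl
        linarith

theorem index_defectSubgroup [NeZero n] :
    (defectSubgroup C hC).index = 2 * C.toAddSubgroup.index := by
  set M := C.toAddSubgroup.comap (reduceTwo n)
  have hle : defectSubgroup C hC ≤ M := fun u hu => hu.1
  have hrel : (defectSubgroup C hC).relIndex M = 2 := by
    rw [AddSubgroup.relIndex_eq_two_iff]
    set a : Fin n → ℤ := Pi.single 0 2 with ha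
    have hda : weightDefect a = 2 := by
      rw [weightDefect, Finset.sum_eq_single 0 (fun i _ hi => by simp [ha, hi]) (by simp)]
      simp [ha]
    have hra : reduceTwo n a ∈ C := by
      have : reduceTwo n a = 0 := by
        rw [reduceTwo_eq_zero_iff]
        intro i
        by_cases hi : i = 0
        · simp [ha, hi]
        · simp [ha, hi]
      rw [this]
      exact C.zero_mem
    refine ⟨a, hra, fun u hu => ?_⟩
    have hu1 : reduceTwo n u ∈ C := hu
    have hadd : reduceTwo n (u + a) ∈ C := by simpa using C.add_mem hu1 hra
    have h1 := hC.two_dvd_sum_mul hu1 hra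
    have h2 : 2 ∣ weightDefect u := Finset.dvd_sum fun i _ => by
      have := (Int.even_mul_pred_self (u i)).two_dvd
      rwa [mul_sub, mul_one, ← sq] at this
    change Xor (_ ∧ 4 ∣ weightDefect (u + a)) (_ ∧ 4 ∣ weightDefect u)
    rw [weightDefect_add, hda]
    simp only [hadd, hu1, true_and, Xor]
    omega
  rw [← AddSubgroup.relIndex_mul_index hle, hrel,
    AddSubgroup.index_comap_of_surjective _ (reduceTwo_surjective n)]

/-- Doubling a sublattice of the integer vectors multiplies its index by `2 ^ n`. -/
theorem index_map_two_nsmul (L : AddSubgroup (Fin n → ℤ)) :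
    (L.map (nsmulAddMonoidHom 2)).index = 2 ^ n * L.index := by
  have hinj : Function.Injective (nsmulAddMonoidHom 2 : (Fin n → ℤ) →+ _) := by
    intro u v h
    ext i
    have := congrFun h i
    simpa using this
  have hrange : (nsmulAddMonoidHom 2 : (Fin n → ℤ) →+ _).range = (reduceTwo n).ker := by
    ext v
    rw [AddMonoidHom.mem_ker, reduceTwo_eq_zero_iff]
    constructor
    · rintro ⟨u, rfl⟩ i
      simp
    · intro h
      refine ⟨fun i => v i / 2, ?_⟩
      ext i
      simpa using Int.mul_ediv_cancel' (h i)
  rw [AddSubgroup.index_map, (AddMonoidHom.ker_eq_bot_iff _).2 hinj, sup_bot_eq, hrange,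
    AddSubgroup.index_ker, AddMonoidHom.range_eq_top.2 (reduceTwo_surjective n)]
  simp [mul_comm]

theorem two_mul_index_cstarSubgroup [NeZero n] (hn : Even n) (h1 : (1 : Fin n → ZMod 2) ∈ C) :
    2 * (cstarSubgroup C hC).index = 2 ^ n * (2 * C.toAddSubgroup.index) := by
  set L := (defectSubgroup C hC).map (nsmulAddMonoidHom 2)
  have hmem : ∀ v ∈ cstarSubgroup C hC, v ∈ L ↔ 2 ∣ v 0 := by
    intro v hv
    constructor
    · rintro ⟨u, -, rfl⟩
      simp
    · intro h
      obtain ⟨e, he, u, hu, hu', rfl⟩ := exists_offset_of_mem_cstarSubgroup hC hn h1 hv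
      have he0 : e = 0 := by
        rcases he with rfl | rfl
        · rfl
        · simp only at h
          omega
      subst he0
      exact ⟨u, ⟨hu, by simpa using hu'⟩, by ext; simp⟩
  have hle : L ≤ cstarSubgroup C hC := by
    rintro _ ⟨u, ⟨hu, hu'⟩, rfl⟩
    exact ⟨0, u, hu, by simpa using hu', by ext; simp⟩
  have hrel : L.relIndex (cstarSubgroup C hC) = 2 := by
    rw [AddSubgroup.relIndex_eq_two_iff]
    have ha : (fun i => 1 + 2 * (Pi.single 0 2 : Fin n → ℤ) i) ∈ cstarSubgroup C hC := by
      refine ⟨1, Pi.single 0 2, ?_, ?_, rfl⟩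
      · have : reduceTwo n (Pi.single 0 2) = 0 := by
          rw [reduceTwo_eq_zero_iff]
          intro i
          by_cases hi : i = 0
          · simp [hi]
          · simp [hi]
        rw [this]
        exact C.zero_mem
      · rw [weightDefect, Finset.sum_eq_single 0 (fun i _ hi => by simp [hi]) (by simp)]
        simp
    refine ⟨_, ha, fun v hv => ?_⟩
    rw [hmem _ hv, hmem _ (add_mem hv ha)]
    simp only [Xor, Pi.add_apply, Pi.single_eq_same]
    omega
  rw [← index_defectSubgroup hC, ← index_map_two_nsmul, ← AddSubgroup.relIndex_mul_index hle, hrel]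

end SelfOrthogonalCode

theorem selfOrthogonal_of_eq_dualCode {n : ℕ} {C : Set (Fin n → ZMod 2)} (h : C = dualCode C) :
    SelfOrthogonal C := by
  intro c hc c' hc'
  rw [h] at hc
  exact hc c' hc'

theorem one_mem_of_eq_dualCode {n : ℕ} {C : Set (Fin n → ZMod 2)} (h : C = dualCode C) :
    (1 : Fin n → ZMod 2) ∈ C := by
  rw [h]
  intro c hc
  have hsq : ∀ x : ZMod 2, x * x = x := by decide
  simpa [hsq] using selfOrthogonal_of_eq_dualCode h c hc c hc

theorem two_mul_finrank_of_eq_dualCode {n : ℕ} {C : Submodule (ZMod 2) (Fin n → ZMod 2)}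
    (h : (C : Set (Fin n → ZMod 2)) = dualCode (C : Set (Fin n → ZMod 2))) :
    2 * Module.finrank (ZMod 2) C = n := by
  have hdual : (C.map (dotProductEquiv (ZMod 2) (Fin n)).toLinearMap).dualCoannihilator = C := by
    apply SetLike.coe_injective
    rw [h]
    ext x
    rw [SetLike.mem_coe, Submodule.mem_dualCoannihilator]
    simp only [Submodule.mem_map, forall_exists_index, and_imp, forall_apply_eq_imp_iff₂]
    simp [dualCode, dotProduct, mul_comm]
  have := Subspace.finrank_add_finrank_dualCoannihilator_eq
    (C.map (dotProductEquiv (ZMod 2) (Fin n)).toLinearMap)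
  rw [hdual, LinearEquiv.finrank_map_eq, Module.finrank_fin_fun] at this
  omega

theorem index_of_eq_dualCode {n : ℕ} {C : Submodule (ZMod 2) (Fin n → ZMod 2)}
    (h : (C : Set (Fin n → ZMod 2)) = dualCode (C : Set (Fin n → ZMod 2))) :
    C.toAddSubgroup.index = 2 ^ (n / 2) := by
  have hrank := two_mul_finrank_of_eq_dualCode h
  have hcard : Nat.card C.toAddSubgroup = 2 ^ (n / 2) := by
    change Nat.card C = _
    rw [Module.natCard_eq_pow_finrank (K := ZMod 2), Nat.card_zmod]
    congr 1
    omega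
  have hmul := C.toAddSubgroup.card_mul_index
  rw [hcard, Nat.card_fun, Nat.card_zmod, Nat.card_fin] at hmul
  have hn : 2 ^ n = 2 ^ (n / 2) * 2 ^ (n / 2) := by
    rw [← pow_add]
    congr 1
    omega
  rw [hn] at hmul
  exact Nat.eq_of_mul_eq_mul_left (by positivity) hmul

theorem two_le_sum_sq {n : ℕ} {w : Fin n → ℤ} (hw : w ≠ 0) (heven : 2 ∣ ∑ i, w i) :
    2 ≤ ∑ i, w i ^ 2 := by
  obtain ⟨j, hj⟩ := Function.ne_iff.1 hw
  have hpos : 0 < ∑ i, w i ^ 2 :=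
    Finset.sum_pos' (fun i _ => sq_nonneg _)
      ⟨j, Finset.mem_univ _, sq_pos_of_ne_zero hj⟩
  have hdiff : 2 ∣ ∑ i, w i ^ 2 - ∑ i, w i := by
    rw [← Finset.sum_sub_distrib]
    refine Finset.dvd_sum fun i _ => ?_
    have := (Int.even_mul_pred_self (w i)).two_dvd
    rwa [mul_sub, mul_one, ← sq] at this
  omega

theorem le_sum_sq_of_mem_Gamma {n d : ℕ} {C : Set (Fin n → ZMod 2)}
    (hd : ∀ c ∈ C, c ≠ 0 → d ≤ wt c) {v : Fin n → ℤ} (hv : v ∈ Gamma C) (hv0 : v ≠ 0) :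
    min (n : ℤ) (min (4 * d) 32) ≤ ∑ i, v i ^ 2 := by
  obtain ⟨c1, c2, c3, z, ⟨hc2, hc⟩, rfl⟩ := hv
  rcases hc with ⟨rfl, hev⟩ | ⟨rfl, -⟩
  · by_cases h2 : c2 = 0
    · subst h2
      set w : Fin n → ℤ := fun i => psi c3 i + 2 * z i with hw
      have hvw : psi 0 + 2 • psi 0 + 4 • psi c3 + 8 • z = fun i => 4 * w i := by
        ext i
        simp [psi, hw]
        ring
      rw [hvw] at hv0 ⊢
      have hw0 : w ≠ 0 := by
        rintro h
        exact hv0 (by simp [h]; rfl)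
      have hsum : 2 ∣ ∑ i, w i := by
        have h := hev.two_dvd
        rw [hw, Finset.sum_add_distrib, sum_psi, ← Finset.mul_sum]
        omega
      have := two_le_sum_sq hw0 hsum
      have h16 : ∑ i, (4 * w i) ^ 2 = 16 * ∑ i, w i ^ 2 := by
        rw [Finset.mul_sum]
        exact Finset.sum_congr rfl fun i _ => by ring
      rw [h16]
      omega
    · have hwt := hd c2 hc2 h2
      have : ∑ i, 4 * psi c2 i ≤
          ∑ i, (psi 0 + 2 • psi c2 + 4 • psi c3 + 8 • z : Fin n → ℤ) i ^ 2 := by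
        refine Finset.sum_le_sum fun i _ => ?_
        have hx : (psi 0 + 2 • psi c2 + 4 • psi c3 + 8 • z : Fin n → ℤ) i =
            2 * (psi c2 i + 2 * (psi c3 i + 2 * z i)) := by
          simp [psi]
          ring
        rw [hx]
        rcases psi_eq_zero_or_one c2 i with h | h
        · rw [h]
          positivity
        · rw [h, mul_pow]
          have : 0 < (1 + 2 * (psi c3 i + 2 * z i)) ^ 2 := by
            apply sq_pos_of_ne_zero
            omega
          omega
      rw [← Finset.mul_sum, sum_psi] at this
      omega
  · have : ∑ _i : Fin n, (1 : ℤ) ≤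
        ∑ i, (psi 1 + 2 • psi c2 + 4 • psi c3 + 8 • z : Fin n → ℤ) i ^ 2 := by
      refine Finset.sum_le_sum fun i _ => ?_
      have hx : (psi 1 + 2 • psi c2 + 4 • psi c3 + 8 • z : Fin n → ℤ) i =
          1 + 2 * (psi c2 i + 2 * (psi c3 i + 2 * z i)) := by
        have h1 : psi (1 : Fin n → ZMod 2) i = 1 := rfl
        simp [h1]
        ring
      rw [hx]
      have : 0 < (1 + 2 * (psi c2 i + 2 * (psi c3 i + 2 * z i))) ^ 2 := by
        apply sq_pos_of_ne_zero
        omega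
      omega
    simp only [Finset.sum_const, Finset.card_univ, Fintype.card_fin, nsmul_eq_mul, mul_one] at this
    exact (min_le_left _ _).trans this

theorem exists_mem_Gamma_sum_sq_eq (C : Submodule (ZMod 2) (Fin 40 → ZMod 2)) :
    ∃ v ∈ Gamma (C : Set (Fin 40 → ZMod 2)), v ≠ 0 ∧ 32 = ∑ i, v i ^ 2 := by
  set c : Fin 40 → ZMod 2 := fun i => if i = 0 ∨ i = 1 then 1 else 0 with hc
  have hwt : wt c = 2 := by
    have : (Finset.univ.filter fun i => c i ≠ 0) = {0, 1} := by
      ext i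
      simp [hc, or_iff_not_imp_left]
    rw [wt, this]
    rfl
  have hsq : ∑ i, (4 * psi c i) ^ 2 = 32 := by
    have h (i : Fin 40) : (4 * psi c i) ^ 2 = 16 * psi c i := by
      rcases psi_eq_zero_or_one c i with h | h <;> simp [h]
    simp only [h, ← Finset.mul_sum, sum_psi, hwt]
    norm_num
  refine ⟨fun i => 4 * psi c i, ⟨0, 0, c, 0, ⟨C.zero_mem, Or.inl ⟨rfl, ?_⟩⟩, ?_⟩, ?_, hsq.symm⟩
  · rw [hwt]
    exact even_two
  · ext i
    simp [psi]
  · intro h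
    simp only [funext_iff] at h
    simp [h] at hsq

/-- with `C2` any self-dual linear binary code of length 40 and minimum
Hamming weight 8, an extremal [40,20,8] code, `Γ` is an additive subgroup of `ℤ^40` of index `2^60`, its minimum
squared norm of a nonzero point is `32`, and its Hermite invariant
`d_min^2 / vol^{2/40}` equals `4`. -/
theorem constructionCstar_dim40
    (C2 : Submodule (ZMod 2) (Fin 40 → ZMod 2))
    (hsd : (C2 : Set (Fin 40 → ZMod 2)) = dualCode (C2 : Set (Fin 40 → ZMod 2)))
    (hmin : IsLeast {w : ℕ | ∃ c ∈ C2, c ≠ 0 ∧ w = wt c} 8) :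
    ∃ H : AddSubgroup (Fin 40 → ℤ),
      Gamma (C2 : Set (Fin 40 → ZMod 2)) = ↑H ∧
      H.index = 2 ^ 60 ∧
      IsLeast {m : ℤ | ∃ v ∈ Gamma (C2 : Set (Fin 40 → ZMod 2)),
        v ≠ 0 ∧ m = ∑ i, (v i) ^ 2} 32 ∧
      (32 : ℝ) / ((H.index : ℝ) ^ ((2 : ℝ) / 40)) = 4 := by
  have hC := selfOrthogonal_of_eq_dualCode hsd
  have h1 : (1 : Fin 40 → ZMod 2) ∈ C2 := one_mem_of_eq_dualCode hsd
  have hn : Even 40 := by decide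
  have hindex : (cstarSubgroup C2 hC).index = 2 ^ 60 := by
    have := two_mul_index_cstarSubgroup hC hn h1
    rw [index_of_eq_dualCode hsd] at this
    norm_num at this ⊢
    omega
  refine ⟨cstarSubgroup C2 hC, gamma_eq_cstarSubgroup hC hn h1, hindex, ⟨?_, ?_⟩, ?_⟩
  · exact exists_mem_Gamma_sum_sq_eq C2
  · rintro m ⟨v, hv, hv0, rfl⟩
    have hd : ∀ c ∈ (C2 : Set (Fin 40 → ZMod 2)), c ≠ 0 → 8 ≤ wt c :=
      fun c hc hc0 => hmin.2 ⟨c, hc, hc0, rfl⟩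
    simpa using le_sum_sq_of_mem_Gamma hd hv hv0
  · have h8 : ((2 : ℝ) ^ 60) ^ ((2 : ℝ) / 40) = 8 := by
      rw [← Real.rpow_natCast, ← Real.rpow_mul (by norm_num)]
      norm_num
    rw [hindex, Nat.cast_pow, Nat.cast_ofNat, h8]
    norm_num
end
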